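/- Let λ denote Lebesgue measure, μ₂ = ½·λ|_{[0,2]} the uniform distribution on [0,2]; set aₙ = ½(Σ_{i=1}^{n−1} 1/i² + Σ_{i=1}^{n} 1/i²) for n ≥ 1, ā = π²/12 + 1, Iₙ = [Σ_{i=1}^{n−1} 1/i², Σ_{i=1}^{n} 1/i²], Ī = [π²/6, 2], and μ₁ = ½·Σ_{n=1}^∞ (1/n²)·δ_{aₙ} + ½·(2 − π²/6)·δ_{ā}. Then M(μ₁, μ₂) consists of exactly one element, namely Q = ½·Σ_{n=1}^∞ δ_{aₙ} ⊗ λ|_{Iₙ} + ½·δ_{ā} ⊗ λ|_{Ī}. -/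

import Mathlib

open MeasureTheory
open scoped BigOperators ENNReal

noncomputable section

namespace MOT2

/-- `Q ∈ M(μ₁, μ₂)`: `Q` is a Borel probability measure on `ℝ²` with marginals `μ₁, μ₂`
under which the coordinate process `(S₁, S₂)` is a martingale, i.e.
`∫ Δ(s₁)(s₂ - s₁) dQ = 0` for every bounded measurable `Δ : ℝ → ℝ`. -/
def IsMartingaleCoupling (Q : Measure (ℝ × ℝ)) (μ₁ μ₂ : Measure ℝ) : Prop :=
  IsProbabilityMeasure Q ∧ Q.map Prod.fst = μ₁ ∧ Q.map Prod.snd = μ₂ ∧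
    ∀ Δ : ℝ → ℝ, Measurable Δ → (∃ C, ∀ x, |Δ x| ≤ C) →
      ∫ p : ℝ × ℝ, Δ p.1 * (p.2 - p.1) ∂Q = 0

end MOT2

namespace CounterEx

/-- `S n = ∑_{i=1}^{n} 1/i²` (partial sums of the Basel series). -/
noncomputable def S (n : ℕ) : ℝ := ∑ i ∈ Finset.range n, (1 : ℝ) / ((i : ℝ) + 1) ^ 2

/-- `a (n)` is the midpoint `aₙ₊₁ = ½ (∑_{i=1}^{n} 1/i² + ∑_{i=1}^{n+1} 1/i²)` of the
interval `Iₙ₊₁`. -/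
noncomputable def a (n : ℕ) : ℝ := (S n + S (n + 1)) / 2

/-- `ā = π²/12 + 1`, the midpoint of `Ī = [π²/6, 2]`. -/
noncomputable def abar : ℝ := Real.pi ^ 2 / 12 + 1

/-- `μ₁ = ½ ∑_{n≥1} (1/n²) δ_{aₙ} + ½ (2 - π²/6) δ_{ā}`. -/
noncomputable def μ₁ : Measure ℝ :=
  Measure.sum (fun n : ℕ =>
      ENNReal.ofReal ((1 / 2 : ℝ) * (1 / ((n : ℝ) + 1) ^ 2)) • Measure.dirac (a n)) +
    ENNReal.ofReal ((1 / 2 : ℝ) * (2 - Real.pi ^ 2 / 6)) • Measure.dirac abar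

/-- `μ₂ = ½ λ|_{[0,2]}`, the uniform distribution on `[0, 2]`. -/
noncomputable def μ₂ : Measure ℝ :=
  ENNReal.ofReal (1 / 2 : ℝ) • volume.restrict (Set.Icc (0 : ℝ) 2)

/-- `Q = ½ ∑_{n≥1} δ_{aₙ} ⊗ λ|_{Iₙ} + ½ δ_{ā} ⊗ λ|_{Ī}`. -/
noncomputable def Q : Measure (ℝ × ℝ) :=
  ENNReal.ofReal (1 / 2 : ℝ) •
      Measure.sum (fun n : ℕ =>
        (Measure.dirac (a n)).prod (volume.restrict (Set.Icc (S n) (S (n + 1))))) +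
    ENNReal.ofReal (1 / 2 : ℝ) •
      (Measure.dirac abar).prod (volume.restrict (Set.Icc (Real.pi ^ 2 / 6) 2))

end CounterEx

namespace MOT2

variable {Q Q' : Measure (ℝ × ℝ)} {μ ν : Measure ℝ}

/-- The defect `∫ (1_{c ≤ y} - 1_{c ≤ x}) (y - c) dQ` depends only on the marginals of a
martingale coupling. -/
theorem IsMartingaleCoupling.integral_indicator_sub_mul (hQ : IsMartingaleCoupling Q μ ν)
    (hμ : Integrable id μ) (hν : Integrable id ν) (c : ℝ) :
    Integrable (fun p : ℝ × ℝ => ((Set.Ici c).indicator (fun _ => (1 : ℝ)) p.2 -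
      (Set.Ici c).indicator (fun _ => (1 : ℝ)) p.1) * (p.2 - c)) Q ∧
    ∫ p : ℝ × ℝ, ((Set.Ici c).indicator (fun _ => (1 : ℝ)) p.2 -
      (Set.Ici c).indicator (fun _ => (1 : ℝ)) p.1) * (p.2 - c) ∂Q =
    ∫ y, (Set.Ici c).indicator (fun _ => (1 : ℝ)) y * (y - c) ∂ν -
      ∫ x, (Set.Ici c).indicator (fun _ => (1 : ℝ)) x * (x - c) ∂μ := by
  obtain ⟨hprob, h₁, h₂, hmart⟩ := hQ
  subst h₁ h₂
  set χ : ℝ → ℝ := (Set.Ici c).indicator fun _ => (1 : ℝ) with hχ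
  have hχm : Measurable χ := measurable_const.indicator measurableSet_Ici
  have hχb : ∀ x, |χ x| ≤ 1 := fun x => by
    by_cases hx : x ∈ Set.Ici c <;> simp [hχ, hx]
  have hχc : Measurable fun x => χ x * (x - c) := by fun_prop
  have hX : Integrable (fun p : ℝ × ℝ => p.1) Q := hμ.comp_measurable measurable_fst
  have hY : Integrable (fun p : ℝ × ℝ => p.2) Q := hν.comp_measurable measurable_snd
  have iY : Integrable (fun p : ℝ × ℝ => χ p.2 * (p.2 - c)) Q :=
    (hY.sub (integrable_const c)).bdd_mul (c := 1)
      (hχm.comp measurable_snd).aestronglyMeasurable (ae_of_all _ fun p => hχb _)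
  have iX : Integrable (fun p : ℝ × ℝ => χ p.1 * (p.1 - c)) Q :=
    (hX.sub (integrable_const c)).bdd_mul (c := 1)
      (hχm.comp measurable_fst).aestronglyMeasurable (ae_of_all _ fun p => hχb _)
  have iXY : Integrable (fun p : ℝ × ℝ => χ p.1 * (p.2 - p.1)) Q :=
    (hY.sub hX).bdd_mul (c := 1)
      (hχm.comp measurable_fst).aestronglyMeasurable (ae_of_all _ fun p => hχb _)
  have hsplit : (fun p : ℝ × ℝ => (χ p.2 - χ p.1) * (p.2 - c)) =
      fun p => χ p.2 * (p.2 - c) - χ p.1 * (p.1 - c) - χ p.1 * (p.2 - p.1) := by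
    ext p; ring
  rw [hsplit]
  refine ⟨(iY.sub iX).sub iXY, ?_⟩
  rw [integral_sub (f := fun p : ℝ × ℝ => χ p.2 * (p.2 - c) - χ p.1 * (p.1 - c)) (iY.sub iX) iXY,
    integral_sub iY iX, hmart χ hχm ⟨1, hχb⟩, sub_zero,
    integral_map measurable_snd.aemeasurable hχc.aestronglyMeasurable,
    integral_map measurable_fst.aemeasurable hχc.aestronglyMeasurable]

/-- If one martingale coupling does not cross the level `c`, then no martingale coupling of the
same marginals does. -/
theorem IsMartingaleCoupling.ae_lt_iff_lt (hQ : IsMartingaleCoupling Q μ ν)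
    (hQ' : IsMartingaleCoupling Q' μ ν) (hμ : Integrable id μ) (hν : Integrable id ν) {c : ℝ}
    (hc : ν {c} = 0) (h : ∀ᵐ p ∂Q, p.1 < c ↔ p.2 < c) : ∀ᵐ p ∂Q', p.1 < c ↔ p.2 < c := by
  obtain ⟨-, hval⟩ := hQ.integral_indicator_sub_mul hμ hν c
  obtain ⟨hint', hval'⟩ := hQ'.integral_indicator_sub_mul hμ hν c
  rw [← hval, integral_eq_zero_of_ae (μ := Q), integral_eq_zero_iff_of_nonneg _ hint'] at hval'
  · have hne : ∀ᵐ p ∂Q', p.2 ≠ c := by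
      refine ae_of_ae_map (f := Prod.snd) (p := fun y => y ≠ c) measurable_snd.aemeasurable ?_
      rw [hQ'.2.2.1]
      exact measure_eq_zero_iff_ae_notMem.1 hc
    filter_upwards [hval', hne] with p hp hpc
    have := (mul_eq_zero.1 hp).resolve_right (sub_ne_zero.2 hpc)
    by_cases h1 : p.1 < c <;> by_cases h2 : p.2 < c <;>
      simp [← not_lt, h1, h2] at this ⊢
  · intro p
    dsimp only [Pi.zero_apply]
    rcases lt_or_ge p.1 c with h1 | (h1 : c ≤ p.1) <;>
      rcases lt_or_ge p.2 c with h2 | (h2 : c ≤ p.2) <;>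
      simp [h1, h2, not_le.2, le_of_lt]
  · filter_upwards [h] with p hp
    by_cases h1 : p.1 < c
    · simp [not_le.2 h1, not_le.2 (hp.1 h1)]
    · simp [not_lt.1 h1, not_lt.1 (mt hp.2 h1)]

end MOT2

namespace CounterEx

theorem S_zero : S 0 = 0 := by simp [S]

theorem S_succ (n : ℕ) : S (n + 1) = S n + 1 / ((n : ℝ) + 1) ^ 2 := by
  simp [S, Finset.sum_range_succ]

theorem S_strictMono : StrictMono S :=
  strictMono_nat_of_lt_succ fun n => by
    rw [S_succ]
    linarith [show (0 : ℝ) < 1 / ((n : ℝ) + 1) ^ 2 by positivity]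

theorem tendsto_S : Filter.Tendsto S Filter.atTop (nhds (Real.pi ^ 2 / 6)) := by
  have h := (hasSum_nat_add_iff' 1).2 hasSum_zeta_two
  simpa only [Nat.cast_add, Nat.cast_one, Finset.sum_range_one, Nat.cast_zero, ne_eq,
    OfNat.ofNat_ne_zero, not_false_eq_true, zero_pow, div_zero, sub_zero] using! h.tendsto_sum_nat

theorem S_lt (n : ℕ) : S n < Real.pi ^ 2 / 6 :=
  (S_strictMono n.lt_succ_self).trans_le (S_strictMono.monotone.ge_of_tendsto tendsto_S _)

theorem S_nonneg (n : ℕ) : 0 ≤ S n := S_zero ▸ S_strictMono.monotone n.zero_le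

theorem pi_sq_div_six_lt_two : Real.pi ^ 2 / 6 < 2 := by
  nlinarith [Real.pi_pos, Real.pi_lt_d2]

theorem S_lt_a (n : ℕ) : S n < a n := by
  unfold a; linarith [S_strictMono n.lt_succ_self]

theorem a_lt_S (n : ℕ) : a n < S (n + 1) := by
  unfold a; linarith [S_strictMono n.lt_succ_self]

theorem a_lt_S_iff {n k : ℕ} : a n < S k ↔ n < k := by
  constructor
  · intro h
    exact S_strictMono.lt_iff_lt.1 ((S_lt_a n).trans h)
  · intro h
    exact (a_lt_S n).trans_le (S_strictMono.monotone h)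

theorem S_lt_abar (n : ℕ) : S n < abar := by
  unfold abar; linarith [S_lt n, pi_sq_div_six_lt_two]

theorem iUnion_Ico_S : ⋃ n, Set.Ico (S n) (S (n + 1)) = Set.Ico 0 (Real.pi ^ 2 / 6) := by
  ext x
  simp only [Set.mem_iUnion, Set.mem_Ico]
  constructor
  · rintro ⟨n, h1, h2⟩
    exact ⟨(S_nonneg n).trans h1, h2.trans (S_lt _)⟩
  · rintro ⟨h0, hx⟩
    have hex : ∃ n, x < S n := (tendsto_S.eventually_const_lt hx).exists
    classical
    have hpos : Nat.find hex ≠ 0 := fun h => by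
      have := Nat.find_spec hex
      rw [h, S_zero] at this
      exact this.not_ge h0
    obtain ⟨m, hm⟩ := Nat.exists_eq_succ_of_ne_zero hpos
    refine ⟨m, not_lt.1 (Nat.find_min hex (by omega)), ?_⟩
    have := Nat.find_spec hex
    rwa [hm] at this

theorem sum_restrict_Icc_S :
    Measure.sum (fun n => volume.restrict (Set.Icc (S n) (S (n + 1)))) +
      volume.restrict (Set.Icc (Real.pi ^ 2 / 6) 2) = volume.restrict (Set.Icc (0 : ℝ) 2) := by
  have hIcc : ∀ n, (volume : Measure ℝ).restrict (Set.Icc (S n) (S (n + 1))) =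
      volume.restrict (Set.Ico (S n) (S (n + 1))) := fun n =>
    Measure.restrict_congr_set Ico_ae_eq_Icc.symm
  simp only [hIcc]
  rw [← Measure.restrict_iUnion (s := fun n => Set.Ico (S n) (S (n + 1)))
      S_strictMono.monotone.pairwise_disjoint_on_Ico_succ fun _ => measurableSet_Ico,
    iUnion_Ico_S, ← Measure.restrict_union _ measurableSet_Icc,
    Set.Ico_union_Icc_eq_Icc (by positivity) pi_sq_div_six_lt_two.le]
  exact Set.disjoint_left.2 fun x hx hx' => hx.2.not_ge hx'.1

theorem map_snd_Q : Q.map Prod.snd = μ₂ := by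
  rw [Q, Measure.map_add _ _ measurable_snd, Measure.map_smul, Measure.map_smul,
    Measure.map_sum measurable_snd.aemeasurable]
  simp only [Measure.map_snd_prod, measure_univ, one_smul]
  rw [← smul_add, sum_restrict_Icc_S, μ₂]

theorem smul_measure_sum {α ι : Type*} [MeasurableSpace α] (c : ℝ≥0∞) (m : ι → Measure α) :
    c • Measure.sum m = Measure.sum fun i => c • m i := by
  ext s hs
  simp [Measure.sum_apply _ hs, ENNReal.tsum_mul_left]

theorem map_fst_Q : Q.map Prod.fst = μ₁ := by
  rw [Q, Measure.map_add _ _ measurable_fst, Measure.map_smul, Measure.map_smul,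
    Measure.map_sum measurable_fst.aemeasurable, μ₁, smul_measure_sum]
  congr 1
  · congr 1
    ext1 n
    rw [Measure.map_fst_prod, Measure.restrict_apply_univ, Real.volume_Icc, smul_smul,
      ← ENNReal.ofReal_mul (by norm_num), S_succ, add_sub_cancel_left]
  · rw [Measure.map_fst_prod, Measure.restrict_apply_univ, Real.volume_Icc, smul_smul,
      ← ENNReal.ofReal_mul (by norm_num)]

instance : IsProbabilityMeasure μ₂ := by
  constructor
  simp only [μ₂, Measure.smul_apply, Measure.restrict_apply_univ, Real.volume_Icc, smul_eq_mul]
  rw [← ENNReal.ofReal_mul (by norm_num)]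
  norm_num

instance : IsProbabilityMeasure Q := by
  constructor
  rw [← Set.preimage_univ (f := Prod.snd), ← Measure.map_apply measurable_snd .univ, map_snd_Q,
    measure_univ]

theorem ae_dirac_prod_restrict (x l u : ℝ) :
    ∀ᵐ p ∂(Measure.dirac x).prod (volume.restrict (Set.Icc l u)),
      p.1 = x ∧ p.2 ∈ Set.Icc l u := by
  rw [Measure.dirac_prod, ae_map_iff measurable_prodMk_left.aemeasurable]
  · filter_upwards [ae_restrict_mem measurableSet_Icc] with y hy
    exact ⟨rfl, hy⟩
  · exact (measurableSet_eq_fun measurable_fst measurable_const).inter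
      (measurable_snd measurableSet_Icc)

theorem ae_Q : ∀ᵐ p ∂Q, (∃ n, p.1 = a n ∧ p.2 ∈ Set.Icc (S n) (S (n + 1))) ∨
    (p.1 = abar ∧ p.2 ∈ Set.Icc (Real.pi ^ 2 / 6) 2) := by
  refine ae_add_measure_iff.2 ⟨Measure.ae_smul_measure (Measure.ae_sum_iff.2 fun n => ?_) _,
    Measure.ae_smul_measure ?_ _⟩
  · filter_upwards [ae_dirac_prod_restrict (a n) (S n) (S (n + 1))] with p hp
    exact .inl ⟨n, hp⟩
  · filter_upwards [ae_dirac_prod_restrict abar (Real.pi ^ 2 / 6) 2] with p hp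
    exact .inr hp

theorem ae_Q_abs_le : ∀ᵐ p ∂Q, |p.1| ≤ 2 ∧ |p.2| ≤ 2 := by
  filter_upwards [ae_Q] with p hp
  have h2 := pi_sq_div_six_lt_two
  have hpi : 0 ≤ Real.pi ^ 2 := by positivity
  rcases hp with ⟨n, h, hl, hu⟩ | ⟨h, hl, hu⟩
  · have := S_nonneg n
    have := S_lt (n + 1)
    have := S_lt_a n
    have := a_lt_S n
    rw [h]
    constructor <;> rw [abs_le] <;> constructor <;> linarith
  · rw [h, abar]
    constructor <;> rw [abs_le] <;> constructor <;> linarith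

theorem integrable_fst_Q : Integrable (fun p : ℝ × ℝ => p.1) Q :=
  .of_bound measurable_fst.aestronglyMeasurable 2 (ae_Q_abs_le.mono fun _ h => h.1)

theorem integrable_snd_Q : Integrable (fun p : ℝ × ℝ => p.2) Q :=
  .of_bound measurable_snd.aestronglyMeasurable 2 (ae_Q_abs_le.mono fun _ h => h.2)

theorem integrable_id_μ₁ : Integrable id μ₁ := by
  rw [← map_fst_Q, integrable_map_measure aestronglyMeasurable_id measurable_fst.aemeasurable]
  exact integrable_fst_Q

theorem integrable_id_μ₂ : Integrable id μ₂ := by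
  rw [← map_snd_Q, integrable_map_measure aestronglyMeasurable_id measurable_snd.aemeasurable]
  exact integrable_snd_Q

/-- The uniform measure on an interval has its midpoint as barycenter. -/
theorem integral_dirac_prod_restrict {l u : ℝ} (hlu : l ≤ u) {Δ : ℝ → ℝ} (hΔ : Measurable Δ) :
    ∫ p : ℝ × ℝ, Δ p.1 * (p.2 - p.1)
      ∂(Measure.dirac ((l + u) / 2)).prod (volume.restrict (Set.Icc l u)) = 0 := by
  have hm : Measurable fun p : ℝ × ℝ => Δ p.1 * (p.2 - p.1) := by fun_prop
  rw [Measure.dirac_prod, integral_map measurable_prodMk_left.aemeasurable hm.aestronglyMeasurable,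
    MeasureTheory.integral_const_mul (Δ ((l + u) / 2)) fun y => y - (l + u) / 2,
    integral_Icc_eq_integral_Ioc, ← intervalIntegral.integral_of_le hlu,
    intervalIntegral.integral_sub (by simp) (by simp), integral_id, intervalIntegral.integral_const,
    smul_eq_mul]
  ring

theorem isMartingaleCoupling_Q : MOT2.IsMartingaleCoupling Q μ₁ μ₂ := by
  refine ⟨inferInstance, map_fst_Q, map_snd_Q, fun Δ hΔ ⟨C, hC⟩ => ?_⟩
  have hint : Integrable (fun p : ℝ × ℝ => Δ p.1 * (p.2 - p.1)) Q :=
    (integrable_snd_Q.sub integrable_fst_Q).bdd_mul (c := C)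
      (hΔ.comp measurable_fst).aestronglyMeasurable (ae_of_all _ fun p => hC _)
  have habar : abar = (Real.pi ^ 2 / 6 + 2) / 2 := by rw [abar]; ring
  rw [Q, integrable_add_measure, integrable_smul_measure (by simp) (by simp)] at hint
  rw [Q, integral_add_measure (hint.1.smul_measure (by simp)) hint.2, integral_smul_measure,
    integral_smul_measure, integral_sum_measure hint.1, habar,
    integral_dirac_prod_restrict pi_sq_div_six_lt_two.le hΔ]
  simp [a, integral_dirac_prod_restrict (S_strictMono (Nat.lt_succ_self _)).le hΔ]

theorem μ₂_singleton (c : ℝ) : μ₂ {c} = 0 := by simp [μ₂]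

theorem ae_Q_lt_S_iff (k : ℕ) : ∀ᵐ p ∂Q, p.1 < S k ↔ p.2 < S k := by
  have hne : ∀ᵐ p ∂Q, p.2 ≠ S k := by
    refine ae_of_ae_map (f := Prod.snd) (p := fun y => y ≠ S k) measurable_snd.aemeasurable ?_
    rw [map_snd_Q]
    exact measure_eq_zero_iff_ae_notMem.1 (μ₂_singleton _)
  filter_upwards [ae_Q, hne] with p hp hpk
  rcases hp with ⟨n, h, hl, hu⟩ | ⟨h, hl, hu⟩
  · rw [h, a_lt_S_iff]
    constructor
    · intro hnk
      exact (hu.trans (S_strictMono.monotone hnk)).lt_of_ne hpk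
    · intro hlt
      exact S_strictMono.lt_iff_lt.1 (hl.trans_lt hlt)
  · rw [h]
    exact iff_of_false (S_lt_abar k).not_gt ((S_lt k).trans_le hl).not_gt

open Classical in
/-- The map sending the interval `[S n, S (n + 1))` to its midpoint `a n`, and everything not
below some `S n` to `abar`. -/
def mid (y : ℝ) : ℝ := if h : ∃ n, y < S (n + 1) then a (Nat.find h) else abar

theorem mid_congr {x y : ℝ} (h : ∀ n, x < S n ↔ y < S n) : mid x = mid y := by
  classical
  exact congrArg (fun P : ℕ → Prop => if h : ∃ n, P n then a (Nat.find h) else abar)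
    (funext fun n => propext (h (n + 1)))

theorem mid_a (n : ℕ) : mid (a n) = a n := by
  classical
  have h : ∃ k, a n < S (k + 1) := ⟨n, a_lt_S n⟩
  rw [mid, dif_pos h]
  congr 1
  rw [Nat.find_eq_iff]
  simp only [a_lt_S_iff]
  exact ⟨n.lt_succ_self, fun m hm => by omega⟩

theorem mid_abar : mid abar = abar :=
  dif_neg fun ⟨n, hn⟩ => (S_lt_abar (n + 1)).not_gt hn

theorem measurable_mid : Measurable mid := by
  classical
  have hex : MeasurableSet {y : ℝ | ∃ n, y < S (n + 1)} := by
    rw [Set.ofPred_exists]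
    exact .iUnion fun n => measurableSet_Iio
  refine Measurable.dite (s := {y : ℝ | ∃ n, y < S (n + 1)})
    (f := fun y => a (Nat.find y.2)) (g := fun _ => abar) ?_ measurable_const hex
  exact (measurable_from_nat (f := a)).comp (measurable_find
    (p := fun (y : {y : ℝ | ∃ n, y < S (n + 1)}) n => (y : ℝ) < S (n + 1)) (fun y => y.2) fun k =>
    measurable_subtype_coe measurableSet_Iio)

theorem ae_fst_eq_mid_of_isMartingaleCoupling {Q' : Measure (ℝ × ℝ)}
    (hQ' : MOT2.IsMartingaleCoupling Q' μ₁ μ₂) : ∀ᵐ p ∂Q', p.1 = mid p.2 := by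
  have hfix : ∀ᵐ p ∂Q', mid p.1 = p.1 := by
    refine ae_of_ae_map (f := Prod.fst) (p := fun x => mid x = x) measurable_fst.aemeasurable ?_
    rw [hQ'.2.1, ← map_fst_Q, ae_map_iff measurable_fst.aemeasurable
      (measurableSet_eq_fun measurable_mid measurable_id')]
    filter_upwards [ae_Q] with p hp
    rcases hp with ⟨n, h, -⟩ | ⟨h, -⟩ <;> simp [h, mid_a, mid_abar]
  have hcross : ∀ᵐ p ∂Q', ∀ k, p.1 < S k ↔ p.2 < S k := ae_all_iff.2 fun k =>
    isMartingaleCoupling_Q.ae_lt_iff_lt hQ' integrable_id_μ₁ integrable_id_μ₂ (μ₂_singleton _)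
      (ae_Q_lt_S_iff k)
  filter_upwards [hfix, hcross] with p hp hp'
  rw [← mid_congr hp', hp]

theorem eq_map_of_isMartingaleCoupling {Q' : Measure (ℝ × ℝ)}
    (hQ' : MOT2.IsMartingaleCoupling Q' μ₁ μ₂) : Q' = μ₂.map fun y => (mid y, y) := by
  rw [← hQ'.2.2.1, Measure.map_map (measurable_mid.prodMk measurable_id') measurable_snd]
  conv_lhs => rw [← Measure.map_id (μ := Q')]
  refine Measure.map_congr ?_
  filter_upwards [ae_fst_eq_mid_of_isMartingaleCoupling hQ'] with p hp
  exact Prod.ext hp rfl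

end CounterEx

open CounterEx in
/-- **Proposition 4.1 setup (uniqueness of the martingale coupling).** For the measures
`μ₁, μ₂` above, `M(μ₁, μ₂)` consists of exactly one element, namely
`Q = ½ ∑_{n≥1} δ_{aₙ} ⊗ λ|_{Iₙ} + ½ δ_{ā} ⊗ λ|_{Ī}`. -/
theorem unique_martingale_coupling :
    MOT2.IsMartingaleCoupling Q μ₁ μ₂ ∧
    ∀ Q' : Measure (ℝ × ℝ), MOT2.IsMartingaleCoupling Q' μ₁ μ₂ → Q' = Q :=
  ⟨isMartingaleCoupling_Q, fun _ hQ' => (eq_map_of_isMartingaleCoupling hQ').trans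
    (eq_map_of_isMartingaleCoupling isMartingaleCoupling_Q).symm⟩
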